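/- Let ħ > 0, m > 0, g ≠ 0 be real, and let Ψ : ℝ³ → ℍ be three times continuously differentiable. Define (ℋΨ)(x) = −(ħ²/2m) Σⱼ (∇ⱼ(∇ⱼΨ))(x), (Q̇ⱼΨ)(x) = −(ħ/m)·ĵ(x)·(∇ⱼΨ)(x), and Bᵏ(x) = g·xᵏ/|x|³. Then for every x ∈ ℝ³ with x ≠ 0 and every i: (1/ħ)·ĵ(x)·( ℋ(Q̇ᵢΨ) − Q̇ᵢ(ℋΨ) )(x) = (1/2m)·(ħ/2g)·Σ_{j,k} ε_{ijk} [ (Q̇ⱼ(Bᵏ·Ψ))(x) + Bᵏ(x)·(Q̇ⱼΨ)(x) ], where Bᵏ·Ψ denotes the function y ↦ Bᵏ(y)Ψ(y). That is, the Heisenberg equations reproduce the Lorentz-force law in the monopole field when the charges satisfy eg = ħ/2. -/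

import Mathlib

noncomputable section
open scoped Quaternion
open MeasureTheory

abbrev R3 : Type := EuclideanSpace ℝ (Fin 3)

/-- Levi-Civita symbol on `Fin 3`. -/
def eps (i j k : Fin 3) : ℝ :=
  (((j : ℕ) : ℝ) - ((i : ℕ) : ℝ)) * (((k : ℕ) : ℝ) - ((i : ℕ) : ℝ)) *
    (((k : ℕ) : ℝ) - ((j : ℕ) : ℝ)) / 2

/-- The quaternionic imaginary units 𝔢₁, 𝔢₂, 𝔢₃. -/
def qe : Fin 3 → ℍ[ℝ] := ![⟨0,1,0,0⟩, ⟨0,0,1,0⟩, ⟨0,0,0,1⟩]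

/-- ĵ(z) = (Σₖ zᵏ 𝔢ₖ)/|z|. -/
def jhat (z : R3) : ℍ[ℝ] := ‖z‖⁻¹ • ∑ k, z k • qe k

/-- Partial derivative ∂ᵢ of a quaternion-valued function. -/
def pderiv (i : Fin 3) (Ψ : R3 → ℍ[ℝ]) (x : R3) : ℍ[ℝ] :=
  fderiv ℝ Ψ x (EuclideanSpace.single i 1)

/-- Covariant derivative ∇ᵢ. -/
def cov (i : Fin 3) (Ψ : R3 → ℍ[ℝ]) (x : R3) : ℍ[ℝ] :=
  pderiv i Ψ x + (1/2 : ℝ) • ∑ j, ∑ k, (eps i j k * x j / ‖x‖^2) • (qe k * Ψ x)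

/-- The quantum Hamiltonian `ℋ = −(hbar²/2m) ∇²`. -/
def Hop (hbar m : ℝ) (Ψ : R3 → ℍ[ℝ]) (x : R3) : ℍ[ℝ] :=
  -(hbar^2 / (2*m)) • ∑ j, cov j (fun y => cov j Ψ y) x

/-- The Heisenberg velocity operator `Q̇ⱼ = −(hbar/m) J ∇ⱼ`. -/
def Qdot (hbar m : ℝ) (j : Fin 3) (Ψ : R3 → ℍ[ℝ]) (x : R3) : ℍ[ℝ] :=
  -(hbar / m) • (jhat x * cov j Ψ x)

/-- The connection form: `∇ᵢ = ∂ᵢ + Aᵢ`. -/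
def conn (i : Fin 3) (x : R3) : ℍ[ℝ] :=
  (‖x‖^2)⁻¹ • ((1/2 : ℝ) • ∑ j, ∑ k, (eps i j k * x j) • qe k)

lemma cov_eq (i : Fin 3) (Ψ : R3 → ℍ[ℝ]) (x : R3) :
    cov i Ψ x = pderiv i Ψ x + conn i x * Ψ x := by
  simp only [cov, conn, Finset.smul_sum, Finset.sum_mul, smul_smul, smul_mul_assoc]
  congr 1
  refine Finset.sum_congr rfl fun j _ => Finset.sum_congr rfl fun k _ => ?_
  congr 1
  ring

lemma contDiffAt_conn {n : ℕ∞} (i : Fin 3) {x : R3} (hx : x ≠ 0) :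
    ContDiffAt ℝ n (conn i) x := by
  unfold conn
  have h : ContDiffAt ℝ n (fun y : R3 => (‖y‖^2)⁻¹) x :=
    (contDiff_norm_sq ℝ).contDiffAt.inv (by simpa using hx)
  refine h.smul (ContDiffAt.const_smul _ ?_)
  refine ContDiffAt.sum fun j _ => ContDiffAt.sum fun k _ => ?_
  fun_prop

lemma contDiffAt_jhat {n : ℕ∞} {x : R3} (hx : x ≠ 0) : ContDiffAt ℝ n jhat x := by
  unfold jhat
  refine ((contDiffAt_norm ℝ hx).inv (by simpa using hx)).smul ?_
  refine ContDiffAt.sum fun k _ => ?_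
  fun_prop

lemma hasFDerivAt_norm_sq_inv {x : R3} (hx : x ≠ 0) :
    HasFDerivAt (fun y : R3 => (‖y‖^2)⁻¹) (-((‖x‖^2)^2)⁻¹ • (2 • innerSL ℝ x)) x := by
  have h := (hasStrictFDerivAt_norm_sq x).hasFDerivAt
  exact (hasDerivAt_inv (by simpa using hx : ‖x‖^2 ≠ 0)).comp_hasFDerivAt x h

lemma pderiv_smul {f : R3 → ℝ} {Ψ : R3 → ℍ[ℝ]} (i : Fin 3) {x : R3}
    (hf : DifferentiableAt ℝ f x) (hΨ : DifferentiableAt ℝ Ψ x) :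
    pderiv i (fun y => f y • Ψ y) x =
      f x • pderiv i Ψ x + fderiv ℝ f x (EuclideanSpace.single i 1) • Ψ x := by
  simp [pderiv, fderiv_fun_smul hf hΨ]

lemma pderiv_mul {Φ Ψ : R3 → ℍ[ℝ]} (i : Fin 3) {x : R3}
    (hΦ : DifferentiableAt ℝ Φ x) (hΨ : DifferentiableAt ℝ Ψ x) :
    pderiv i (fun y => Φ y * Ψ y) x = Φ x * pderiv i Ψ x + pderiv i Φ x * Ψ x := by
  simp [pderiv, fderiv_fun_mul' hΦ hΨ]

lemma pderiv_sum_coord (c : Fin 3 → ℍ[ℝ]) (i : Fin 3) (x : R3) :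
    pderiv i (fun y : R3 => ∑ j, y j • c j) x = c i := by
  have h : HasFDerivAt (fun y : R3 => ∑ j, y j • c j)
      (∑ j, (EuclideanSpace.proj j : R3 →L[ℝ] ℝ).smulRight (c j)) x := by
    refine HasFDerivAt.fun_sum fun j _ => ?_
    exact ((EuclideanSpace.proj j : R3 →L[ℝ] ℝ).hasFDerivAt).smul_const (c j)
  rw [pderiv, h.fderiv]
  simp

lemma pderiv_conn (j i : Fin 3) {x : R3} (hx : x ≠ 0) :
    pderiv j (conn i) x = (‖x‖^2)⁻¹ • ((1/2 : ℝ) • ∑ k, eps i j k • qe k)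
      - (2 * x j * (‖x‖^2)⁻¹) • conn i x := by
  have e : conn i = fun y : R3 => (‖y‖^2)⁻¹ • ∑ l, y l • ((1/2 : ℝ) • ∑ k, eps i l k • qe k) := by
    funext y
    simp only [conn, Finset.smul_sum, smul_smul]
    refine Finset.sum_congr rfl fun j _ => Finset.sum_congr rfl fun k _ => ?_
    congr 1
    ring
  have h := hasFDerivAt_norm_sq_inv hx
  have hval : (-((‖x‖^2)^2)⁻¹ • (2 • innerSL ℝ x)) (EuclideanSpace.single j 1) =
      -(2 * x j * (‖x‖^2)⁻¹ * (‖x‖^2)⁻¹) := by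
    simp [EuclideanSpace.inner_single_right]
    ring
  rw [congrFun e x, e, pderiv_smul j h.differentiableAt (by fun_prop), pderiv_sum_coord, h.fderiv,
    hval]
  module

lemma pderiv_jhat (j : Fin 3) {x : R3} (hx : x ≠ 0) :
    pderiv j jhat x = ‖x‖⁻¹ • qe j - (x j * (‖x‖^2)⁻¹) • jhat x := by
  have hn : ‖x‖ ≠ 0 := by simpa using hx
  have h := ((hasStrictFDerivAt_norm_sq x).hasFDerivAt.sqrt (by simpa using hx))
  simp only [Real.sqrt_sq (norm_nonneg _)] at h
  have h2 := (hasDerivAt_inv hn).comp_hasFDerivAt x h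
  have h3 : HasFDerivAt (fun y : R3 => ‖y‖⁻¹) _ x := h2
  have hval : (-(‖x‖ ^ 2)⁻¹ • (1 / (2 * ‖x‖)) • 2 • innerSL ℝ x) (EuclideanSpace.single j 1) =
      -(x j * (‖x‖^2)⁻¹ * ‖x‖⁻¹) := by
    simp [EuclideanSpace.inner_single_right]
    field_simp
  unfold jhat
  rw [pderiv_smul j h3.differentiableAt (by fun_prop), pderiv_sum_coord, h3.fderiv, hval]
  module

lemma norm_sq_coord (x : R3) : ‖x‖^2 = x 0 ^ 2 + x 1 ^ 2 + x 2 ^ 2 := by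
  simp [EuclideanSpace.norm_sq_eq, Fin.sum_univ_three]

lemma qe_re (k : Fin 3) : (qe k).re = 0 := by fin_cases k <;> rfl

lemma qe_imI (k : Fin 3) : (qe k).imI = if k = 0 then 1 else 0 := by fin_cases k <;> rfl

lemma qe_imJ (k : Fin 3) : (qe k).imJ = if k = 1 then 1 else 0 := by fin_cases k <;> rfl

lemma qe_imK (k : Fin 3) : (qe k).imK = if k = 2 then 1 else 0 := by fin_cases k <;> rfl

/-- `ĵ` is parallel. -/
lemma pderiv_jhat_add_commutator (j : Fin 3) {x : R3} (hx : x ≠ 0) :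
    pderiv j jhat x + conn j x * jhat x = jhat x * conn j x := by
  have hn : ‖x‖ ≠ 0 := by simpa using hx
  have hs := norm_sq_coord x
  rw [pderiv_jhat j hx]
  have hr : ‖x‖⁻¹ = ‖x‖⁻¹ * ((‖x‖^2)⁻¹ * (x 0 ^ 2 + x 1 ^ 2 + x 2 ^ 2)) := by
    rw [← hs]; field_simp
  rw [hr]
  unfold jhat conn
  generalize ‖x‖⁻¹ = a
  generalize (‖x‖^2)⁻¹ = b
  fin_cases j <;> ext <;>
    simp [Fin.sum_univ_three, qe_re, qe_imI, qe_imJ, qe_imK, eps] <;> ring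

set_option maxHeartbeats 2000000 in
lemma conn_curvature (j i : Fin 3) {x : R3} (hx : x ≠ 0) :
    pderiv j (conn i) x - pderiv i (conn j) x + (conn j x * conn i x - conn i x * conn j x) =
      (∑ k, eps i j k * (x k / ‖x‖^3) / 2) • jhat x := by
  have hn : ‖x‖ ≠ 0 := by simpa using hx
  have hs := norm_sq_coord x
  rw [pderiv_conn j i hx, pderiv_conn i j hx]
  have hr : (‖x‖^2)⁻¹ = (‖x‖^2)⁻¹ * ((‖x‖^2)⁻¹ * (x 0 ^ 2 + x 1 ^ 2 + x 2 ^ 2)) := by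
    rw [← hs]; field_simp
  have hj : jhat x = (‖x‖⁻¹) • ∑ l, x l • qe l := rfl
  have hq : (∑ k, eps i j k * (x k / ‖x‖^3) / 2) • jhat x =
      (∑ k, eps i j k * x k * ((‖x‖^2)⁻¹ * (‖x‖^2)⁻¹) / 2) • ∑ l, x l • qe l := by
    rw [hj, smul_smul, Finset.sum_mul]
    congr 1
    refine Finset.sum_congr rfl fun k _ => ?_
    field_simp
  rw [hq]
  have h4 : ∀ v : ℍ[ℝ], (‖x‖^2)⁻¹ • v
      = ((‖x‖^2)⁻¹ * ((‖x‖^2)⁻¹ * (x 0 ^ 2 + x 1 ^ 2 + x 2 ^ 2))) • v := fun v => by rw [← hr]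
  rw [h4 ((1/2 : ℝ) • ∑ k, eps i j k • qe k), h4 ((1/2 : ℝ) • ∑ k, eps j i k • qe k)]
  unfold conn
  generalize (‖x‖^2)⁻¹ = b
  fin_cases j <;> fin_cases i <;> ext <;>
    simp [Fin.sum_univ_three, qe_re, qe_imI, qe_imJ, qe_imK, eps] <;> ring

lemma contDiffAt_cov {n : ℕ} {Ψ : R3 → ℍ[ℝ]} {x : R3} (i : Fin 3) (hx : x ≠ 0)
    (hΨ : ContDiffAt ℝ ((n + 1 : ℕ) : ℕ∞) Ψ x) : ContDiffAt ℝ (n : ℕ∞) (cov i Ψ) x := by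
  rw [show cov i Ψ = fun y => pderiv i Ψ y + conn i y * Ψ y from funext fun y => cov_eq i Ψ y]
  have h : ContDiffAt ℝ (n : ℕ∞) (fderiv ℝ Ψ) x := hΨ.fderiv_right (by norm_cast)
  refine (h.clm_apply contDiffAt_const).add ((contDiffAt_conn i hx).mul (hΨ.of_le ?_))
  norm_cast
  omega

lemma cov_congr {Φ Ψ : R3 → ℍ[ℝ]} {x : R3} (i : Fin 3) (h : Φ =ᶠ[nhds x] Ψ) :
    cov i Φ x = cov i Ψ x := by
  rw [cov_eq, cov_eq, pderiv, pderiv, h.fderiv_eq, h.eq_of_nhds]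

lemma cov_add {Φ Ψ : R3 → ℍ[ℝ]} {x : R3} (i : Fin 3) (hΦ : DifferentiableAt ℝ Φ x)
    (hΨ : DifferentiableAt ℝ Ψ x) :
    cov i (fun y => Φ y + Ψ y) x = cov i Φ x + cov i Ψ x := by
  simp only [cov_eq, pderiv, fderiv_fun_add hΦ hΨ, add_apply, mul_add]
  abel

lemma cov_sum {ι : Type*} (s : Finset ι) {Φ : ι → R3 → ℍ[ℝ]} {x : R3} (i : Fin 3)
    (hΦ : ∀ k ∈ s, DifferentiableAt ℝ (Φ k) x) :
    cov i (fun y => ∑ k ∈ s, Φ k y) x = ∑ k ∈ s, cov i (Φ k) x := by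
  simp only [cov_eq, pderiv, fderiv_fun_sum hΦ, sum_apply, Finset.mul_sum,
    Finset.sum_add_distrib]

lemma cov_const_smul {Ψ : R3 → ℍ[ℝ]} {x : R3} (i : Fin 3) (c : ℝ)
    (hΨ : DifferentiableAt ℝ Ψ x) :
    cov i (fun y => c • Ψ y) x = c • cov i Ψ x := by
  simp [cov_eq, pderiv, fderiv_fun_const_smul hΨ, smul_add]

lemma cov_jhat_mul {Ψ : R3 → ℍ[ℝ]} {x : R3} (i : Fin 3) (hx : x ≠ 0)
    (hΨ : DifferentiableAt ℝ Ψ x) :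
    cov i (fun y => jhat y * Ψ y) x = jhat x * cov i Ψ x := by
  have hj : DifferentiableAt ℝ jhat x := (contDiffAt_jhat (n := 1) hx).differentiableAt (by simp)
  rw [cov_eq, cov_eq, pderiv_mul i hj hΨ, mul_add, ← mul_assoc (jhat x),
    ← pderiv_jhat_add_commutator i hx]
  noncomm_ring

lemma jhat_mul_self {x : R3} (hx : x ≠ 0) (q : ℍ[ℝ]) : jhat x * (jhat x * q) = -q := by
  have hn : ‖x‖ ≠ 0 := by simpa using hx
  have h : jhat x * jhat x = -1 := by
    have hr : ‖x‖⁻¹ * ‖x‖⁻¹ * (x 0 ^ 2 + x 1 ^ 2 + x 2 ^ 2) = 1 := by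
      rw [← norm_sq_coord x]; field_simp
    rw [jhat]
    generalize ‖x‖⁻¹ = a at *
    ext <;> simp [Fin.sum_univ_three, qe_re, qe_imI, qe_imJ, qe_imK] <;> linarith
  rw [← mul_assoc, h, neg_one_mul]

lemma pderiv_comm {Ψ : R3 → ℍ[ℝ]} {x : R3} (i j : Fin 3) (hΨ : ContDiffAt ℝ 2 Ψ x) :
    pderiv i (pderiv j Ψ) x = pderiv j (pderiv i Ψ) x := by
  have hd : DifferentiableAt ℝ (fderiv ℝ Ψ) x :=
    (hΨ.fderiv_right (m := 1) (by norm_num)).differentiableAt (by simp)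
  have h (a b : Fin 3) : pderiv a (pderiv b Ψ) x =
      fderiv ℝ (fderiv ℝ Ψ) x (EuclideanSpace.single a 1) (EuclideanSpace.single b 1) := by
    rw [pderiv]
    unfold pderiv
    rw [fderiv_clm_apply hd (differentiableAt_const _)]
    simp
  rw [h, h]
  exact (hΨ.isSymmSndFDerivAt (by simp)).eq _ _

/-- The curvature of the connection is the monopole field times `ĵ`. -/
lemma cov_cov_sub {Ψ : R3 → ℍ[ℝ]} {x : R3} (j i : Fin 3) (hx : x ≠ 0)
    (hΨ : ContDiffAt ℝ 2 Ψ x) :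
    cov j (cov i Ψ) x = cov i (cov j Ψ) x +
      jhat x * ∑ k, (eps i j k / 2) • (x k / ‖x‖^3) • Ψ x := by
  have hd : DifferentiableAt ℝ Ψ x := hΨ.differentiableAt (by simp)
  have hc (a : Fin 3) : DifferentiableAt ℝ (conn a) x :=
    (contDiffAt_conn (n := 1) a hx).differentiableAt (by simp)
  have hp (a : Fin 3) : DifferentiableAt ℝ (pderiv a Ψ) x :=
    ((hΨ.fderiv_right (m := 1) (by norm_num)).clm_apply contDiffAt_const).differentiableAt (by simp)
  have hcov (a b : Fin 3) : cov a (cov b Ψ) x = pderiv a (pderiv b Ψ) x +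
      (conn b x * pderiv a Ψ x + pderiv a (conn b) x * Ψ x) +
      conn a x * (pderiv b Ψ x + conn b x * Ψ x) := by
    rw [cov_eq, cov_eq, show cov b Ψ = fun y => pderiv b Ψ y + conn b y * Ψ y from
      funext fun y => cov_eq b Ψ y, ← pderiv_mul a (hc b) hd]
    conv_lhs => rw [pderiv, fderiv_fun_add (hp b) ((hc b).fun_mul hd)]
    rfl
  have key := congrArg (· * Ψ x) (conn_curvature j i hx)
  have hr : jhat x * ∑ k, (eps i j k / 2) • (x k / ‖x‖^3) • Ψ x =
      (∑ k, eps i j k * (x k / ‖x‖^3) / 2) • jhat x * Ψ x := by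
    simp only [smul_smul, ← Finset.sum_smul, mul_smul_comm, smul_mul_assoc]
    congr 1
    refine Finset.sum_congr rfl fun k _ => ?_
    ring
  rw [hr, ← key, hcov, hcov, pderiv_comm i j hΨ]
  noncomm_ring

lemma differentiableAt_monopole_smul {Ψ : R3 → ℍ[ℝ]} {x : R3} (k : Fin 3) (hx : x ≠ 0)
    (hΨ : DifferentiableAt ℝ Ψ x) :
    DifferentiableAt ℝ (fun y : R3 => (y k / ‖y‖^3) • Ψ y) x := by
  have hn : DifferentiableAt ℝ (fun y : R3 => ‖y‖) x :=
    (contDiffAt_norm ℝ hx (n := 1)).differentiableAt (by simp)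
  have hk : DifferentiableAt ℝ (fun y : R3 => y k) x := by fun_prop
  have hn0 : ‖x‖^3 ≠ 0 := by simpa using hx
  have hp : DifferentiableAt ℝ (fun y : R3 => ‖y‖^3) x := hn.fun_pow 3
  simp only [div_eq_mul_inv]
  exact (hk.fun_mul (hp.fun_inv hn0)).fun_smul hΨ

lemma cov_laplacian_commutator {Ψ : R3 → ℍ[ℝ]} {x : R3} (i : Fin 3) (hx : x ≠ 0)
    (hΨ : ContDiff ℝ 3 Ψ) :
    ∑ j, cov j (cov j (cov i Ψ)) x - ∑ j, cov i (cov j (cov j Ψ)) x =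
      jhat x * ∑ j, ∑ k, (eps i j k / 2) •
        (cov j (fun y => (y k / ‖y‖^3) • Ψ y) x + (x k / ‖x‖^3) • cov j Ψ x) := by
  have hev : ∀ᶠ y in nhds x, y ≠ 0 := isOpen_ne.mem_nhds hx
  have h2 : ContDiff ℝ 2 Ψ := hΨ.of_le (by norm_num)
  have hc (a : Fin 3) : ContDiffAt ℝ 2 (cov a Ψ) x := by
    exact_mod_cast contDiffAt_cov (n := 2) a hx (by exact_mod_cast hΨ.contDiffAt)
  have hcc (a b : Fin 3) : DifferentiableAt ℝ (cov a (cov b Ψ)) x := by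
    refine ContDiffAt.differentiableAt (n := ((1 : ℕ) : ℕ∞)) ?_ (by simp)
    exact contDiffAt_cov (n := 1) a hx (by exact_mod_cast hc b)
  have hB (k : Fin 3) : DifferentiableAt ℝ (fun y : R3 => (y k / ‖y‖^3) • Ψ y) x :=
    differentiableAt_monopole_smul k hx (h2.differentiable (by simp) x)
  have hj : DifferentiableAt ℝ jhat x := (contDiffAt_jhat (n := 1) hx).differentiableAt (by simp)
  rw [← Finset.sum_sub_distrib, Finset.mul_sum]
  refine Finset.sum_congr rfl fun j _ => ?_
  have hS : DifferentiableAt ℝ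
      (fun y => ∑ k, (eps i j k / 2) • (y k / ‖y‖^3) • Ψ y) x :=
    DifferentiableAt.fun_sum fun k _ => (hB k).fun_const_smul _
  have e1 : cov j (cov j (cov i Ψ)) x = cov j (cov i (cov j Ψ)) x +
      jhat x * ∑ k, (eps i j k / 2) • cov j (fun y => (y k / ‖y‖^3) • Ψ y) x := by
    rw [cov_congr j (hev.mono fun y hy => cov_cov_sub j i hy h2.contDiffAt),
      cov_add j (hcc i j) (hj.fun_mul hS), cov_jhat_mul j hx hS,
      cov_sum _ j fun k _ => (hB k).fun_const_smul _]
    simp only [cov_const_smul j _ (hB _)]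
  rw [e1, cov_cov_sub j i hx (hc j)]
  simp only [smul_add, Finset.sum_add_distrib, mul_add]
  abel

/-- the Heisenberg equations reproduce the Lorentz-force law in the
monopole field `Bᵏ(x) = g xᵏ/|x|³` when `eg = hbar/2`. -/
theorem stmt10 (hbar m g : ℝ) (hh : 0 < hbar) (hm : 0 < m) (hg : g ≠ 0)
    (Ψ : R3 → ℍ[ℝ]) (hΨ : ContDiff ℝ 3 Ψ) (x : R3) (hx : x ≠ 0) (i : Fin 3) :
    (1/hbar) • (jhat x *
        (Hop hbar m (fun y => Qdot hbar m i Ψ y) x - Qdot hbar m i (fun y => Hop hbar m Ψ y) x)) =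
      (1/(2*m) * (hbar/(2*g))) • ∑ j, ∑ k, eps i j k •
        (Qdot hbar m j (fun y => (g * y k / ‖y‖^3) • Ψ y) x
          + (g * x k / ‖x‖^3) • Qdot hbar m j Ψ x) := by
  have hev : ∀ᶠ y in nhds x, y ≠ 0 := isOpen_ne.mem_nhds hx
  have hc (a : Fin 3) {y : R3} (hy : y ≠ 0) : ContDiffAt ℝ 2 (cov a Ψ) y := by
    exact_mod_cast contDiffAt_cov (n := 2) a hy (by exact_mod_cast hΨ.contDiffAt)
  have hcc (a b : Fin 3) {y : R3} (hy : y ≠ 0) : DifferentiableAt ℝ (cov a (cov b Ψ)) y := by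
    refine ContDiffAt.differentiableAt (n := ((1 : ℕ) : ℕ∞)) ?_ (by simp)
    exact contDiffAt_cov (n := 1) a hy (by exact_mod_cast hc b hy)
  have hj {y : R3} (hy : y ≠ 0) : DifferentiableAt ℝ jhat y :=
    (contDiffAt_jhat (n := 1) hy).differentiableAt (by simp)
  have hcd {y : R3} (hy : y ≠ 0) : DifferentiableAt ℝ (cov i Ψ) y :=
    (hc i hy).differentiableAt (by simp)
  have e1 (j : Fin 3) {y : R3} (hy : y ≠ 0) : cov j (fun y => Qdot hbar m i Ψ y) y =
      -(hbar / m) • (jhat y * cov j (cov i Ψ) y) := by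
    simp only [Qdot]
    rw [cov_const_smul j _ ((hj hy).fun_mul (hcd hy)), cov_jhat_mul j hy (hcd hy)]
  have e2 (j : Fin 3) : cov j (fun y => cov j (fun y => Qdot hbar m i Ψ y) y) x =
      -(hbar / m) • (jhat x * cov j (cov j (cov i Ψ)) x) := by
    rw [cov_congr j (hev.mono fun y hy => e1 j hy),
      cov_const_smul j _ ((hj hx).fun_mul (hcc j i hx)), cov_jhat_mul j hx (hcc j i hx)]
  have e3 : cov i (fun y => Hop hbar m Ψ y) x =
      -(hbar^2 / (2*m)) • ∑ j, cov i (cov j (cov j Ψ)) x := by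
    simp only [Hop]
    rw [cov_const_smul i _ (DifferentiableAt.fun_sum fun j _ => hcc j j hx),
      cov_sum _ i fun j _ => hcc j j hx]
  have hB (k : Fin 3) : DifferentiableAt ℝ (fun y : R3 => (y k / ‖y‖^3) • Ψ y) x :=
    differentiableAt_monopole_smul k hx (hΨ.differentiable (by simp) x)
  have e4 (j k : Fin 3) : cov j (fun y => (g * y k / ‖y‖^3) • Ψ y) x =
      g • cov j (fun y => (y k / ‖y‖^3) • Ψ y) x := by
    rw [← cov_const_smul j g (hB k)]
    simp only [smul_smul, mul_div_assoc]
  have hL : Hop hbar m (fun y => Qdot hbar m i Ψ y) x - Qdot hbar m i (fun y => Hop hbar m Ψ y) x =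
      (hbar^3 / (2*m^2)) • (jhat x *
        (∑ j, cov j (cov j (cov i Ψ)) x - ∑ j, cov i (cov j (cov j Ψ)) x)) := by
    rw [Hop, Qdot, e3]
    simp only [e2]
    rw [← Finset.smul_sum, ← Finset.mul_sum, smul_smul, mul_smul_comm, smul_smul, mul_sub, smul_sub]
    congr 2 <;> field_simp
  rw [hL, cov_laplacian_commutator i hx hΨ, mul_smul_comm, jhat_mul_self hx]
  simp only [Qdot, e4, Finset.mul_sum, Finset.smul_sum, ← Finset.sum_neg_distrib]
  refine Finset.sum_congr rfl fun j _ => Finset.sum_congr rfl fun k _ => ?_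
  simp only [mul_smul_comm, mul_add, smul_add, smul_smul, ← neg_smul, neg_add]
  congr 2 <;> field_simp
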